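/- Suppose n = 2 and d ≥ 3. Then for all integers i with 1 ≤ i ≤ 3d−3 and all integers q ≥ 2, the Veronese–Koszul complex at (i,q) is exact. (Equivalently, the d-uple Veronese embedding of P^2 satisfies property N_{3d−3}.) -/

import Mathlib

open TensorProduct

noncomputable section

variable (K : Type*) [Field K]

/-- `S K n e` is the space of homogeneous polynomials of degree `e`
in the `n+1` variables `x_0, …, x_n`. -/
abbrev S (n e : ℕ) : Submodule K (MvPolynomial (Fin (n + 1)) K) :=
  MvPolynomial.homogeneousSubmodule (Fin (n + 1)) K e

/-- The product of a homogeneous polynomial of degree `d` with one of degree `b`,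
viewed as an element of degree `b + d`. -/
def mulSW {n d b : ℕ} (s : S K n d) (w : S K n b) : S K n (b + d) :=
  ⟨(s : MvPolynomial (Fin (n + 1)) K) * (w : MvPolynomial (Fin (n + 1)) K), by
    rw [MvPolynomial.mem_homogeneousSubmodule, Nat.add_comm b d]
    exact ((MvPolynomial.mem_homogeneousSubmodule _ _).1 s.2).mul
      ((MvPolynomial.mem_homogeneousSubmodule _ _).1 w.2)⟩

/-- Identification of spaces of homogeneous polynomials of equal degrees. -/
def scast {n e₁ e₂ : ℕ} (h : e₁ = e₂) : S K n e₁ ≃ₗ[K] S K n e₂ :=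
  LinearEquiv.ofEq _ _ (by rw [h])

/-- The increasing injection `Fin (a-1) → Fin a` omitting `j`. -/
def skipAt {a : ℕ} (j : Fin a) (i : Fin (a - 1)) : Fin a :=
  if (i : ℕ) < (j : ℕ) then ⟨i, by have := i.isLt; omega⟩
  else ⟨(i : ℕ) + 1, by have := i.isLt; omega⟩

/-- The wedge `v 0 ∧ ⋯ ∧ v (a-1)` as an element of the `a`-th exterior power. -/
def wedge {M : Type*} [AddCommGroup M] [Module K M] (a : ℕ) (v : Fin a → M) :
    ⋀[K]^a M :=
  ⟨ExteriorAlgebra.ιMulti K a v, ExteriorAlgebra.ιMulti_range K a ⟨v, rfl⟩⟩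

/-- `IsKoszulMap K n d a b δ` says that `δ : ⋀^a S_d ⊗ S_b → ⋀^{a-1} S_d ⊗ S_{b+d}` is
the Koszul map, i.e. it satisfies
`δ((s_1 ∧ ⋯ ∧ s_a) ⊗ w) = Σ_j (−1)^{j−1} (s_1 ∧ ⋯ ∧ ŝ_j ∧ ⋯ ∧ s_a) ⊗ (s_j·w)`. -/
def IsKoszulMap (n d a b : ℕ)
    (δ : ((⋀[K]^a (S K n d)) ⊗[K] (S K n b)) →ₗ[K]
         ((⋀[K]^(a - 1) (S K n d)) ⊗[K] (S K n (b + d)))) : Prop :=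
  ∀ (s : Fin a → S K n d) (w : S K n b),
    δ (wedge K a s ⊗ₜ[K] w) =
      ∑ j : Fin a, ((-1 : K) ^ (j : ℕ)) •
        ((wedge K (a - 1) fun i => s (skipAt j i)) ⊗ₜ[K] mulSW K (s j) w)

/-- Exactness of the Veronese–Koszul complex at `(i, q)`:
`ker δ_{i,qd} = im δ_{i+1,(q−1)d}` inside `⋀^i S_d ⊗ S_{qd}`. -/
def VKExact (n d i q : ℕ) : Prop :=
  ∀ (h : (q - 1) * d + d = q * d)
    (δ₁ : ((⋀[K]^i (S K n d)) ⊗[K] (S K n (q * d))) →ₗ[K]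
          ((⋀[K]^(i - 1) (S K n d)) ⊗[K] (S K n (q * d + d))))
    (δ₂ : ((⋀[K]^(i + 1) (S K n d)) ⊗[K] (S K n ((q - 1) * d))) →ₗ[K]
          ((⋀[K]^i (S K n d)) ⊗[K] (S K n ((q - 1) * d + d)))),
    IsKoszulMap K n d i (q * d) δ₁ → IsKoszulMap K n d (i + 1) ((q - 1) * d) δ₂ →
    LinearMap.ker δ₁ =
      LinearMap.range
        ((TensorProduct.congr (LinearEquiv.refl K (⋀[K]^i (S K n d)))
            (scast K h)).toLinearMap ∘ₗ δ₂)

end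

noncomputable section

section Ext

variable {K : Type*} [Field K] {V : Type*} [AddCommGroup V] [Module K V]

/-- contraction of the exterior algebra by a linear form -/
def ct (φ : Module.Dual K V) : ExteriorAlgebra K V →ₗ[K] ExteriorAlgebra K V :=
  CliffordAlgebra.contractLeft (Q := (0 : QuadraticForm K V)) φ

lemma ct_ι_mul (φ : Module.Dual K V) (v : V) (x : ExteriorAlgebra K V) :
    ct φ (ExteriorAlgebra.ι K v * x) = φ v • x - ExteriorAlgebra.ι K v * ct φ x :=
  CliffordAlgebra.contractLeft_ι_mul φ v x

lemma ct_one (φ : Module.Dual K V) : ct φ (1 : ExteriorAlgebra K V) = 0 :=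
  CliffordAlgebra.contractLeft_one 0 φ

lemma ct_comm (φ ψ : Module.Dual K V) (x : ExteriorAlgebra K V) :
    ct φ (ct ψ x) = - ct ψ (ct φ x) :=
  CliffordAlgebra.contractLeft_comm φ ψ x

lemma ct_sum {ι : Type*} (s : Finset ι) (c : ι → K) (φ : ι → Module.Dual K V)  :
    ct (∑ i ∈ s, c i • φ i) = ∑ i ∈ s, c i • ct (φ i) := by
  simp [ct, map_sum]

lemma ct_ιMulti (φ : Module.Dual K V) (a : ℕ) (v : Fin (a + 1) → V) :
    ct φ (ExteriorAlgebra.ιMulti K (a + 1) v) =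
      ∑ j : Fin (a + 1), ((-1 : K) ^ (j : ℕ) * φ (v j)) •
        ExteriorAlgebra.ιMulti K a (fun i => v (j.succAbove i)) := by
  induction a with
  | zero =>
    rw [ExteriorAlgebra.ιMulti_succ_apply, ct_ι_mul]
    simp [ct_one]
  | succ a ih =>
    rw [ExteriorAlgebra.ιMulti_succ_apply, ct_ι_mul, ih, Finset.mul_sum, Fin.sum_univ_succ (n := a + 1),
      sub_eq_add_neg, ← Finset.sum_neg_distrib]
    congr 1
    · simp [Matrix.vecTail, Function.comp_def]
    · refine Finset.sum_congr rfl fun j _ => ?_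
      rw [ExteriorAlgebra.ιMulti_succ_apply, mul_smul_comm, ← neg_smul]
      simp [Matrix.vecTail, Function.comp_def, pow_succ, Fin.succ_succAbove_succ]

lemma ct_mem (φ : Module.Dual K V) (a : ℕ) {x : ExteriorAlgebra K V}
    (hx : x ∈ ⋀[K]^(a + 1) V) : ct φ x ∈ ⋀[K]^a V := by
  rw [← ExteriorAlgebra.ιMulti_span_fixedDegree] at hx
  induction hx using Submodule.span_induction with
  | mem x h =>
    obtain ⟨v, rfl⟩ := h
    rw [ct_ιMulti]
    exact Submodule.sum_mem _ fun j _ => Submodule.smul_mem _ _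
      (ExteriorAlgebra.ιMulti_range K a ⟨_, rfl⟩)
  | zero => simp
  | add x y _ _ hx hy => rw [map_add]; exact add_mem hx hy
  | smul c x _ hx => rw [map_smul]; exact Submodule.smul_mem _ _ hx

lemma ι_mul_mem (v : V) (a : ℕ) {x : ExteriorAlgebra K V}
    (hx : x ∈ ⋀[K]^a V) : ExteriorAlgebra.ι K v * x ∈ ⋀[K]^(a + 1) V := by
  rw [ExteriorAlgebra.exteriorPower, pow_succ']
  exact Submodule.mul_mem_mul ⟨v, rfl⟩ hx

/-- iterated contraction -/
def cts (l : List (Module.Dual K V)) : Module.End K (ExteriorAlgebra K V) :=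
  (l.map ct).prod

lemma cts_mem (l : List (Module.Dual K V)) (a : ℕ) {x : ExteriorAlgebra K V}
    (hx : x ∈ ⋀[K]^(a + l.length) V) : cts l x ∈ ⋀[K]^a V := by
  induction l generalizing a with
  | nil => simpa [cts] using hx
  | cons φ l ih =>
    have : cts (φ :: l) x = ct φ (cts l x) := by simp [cts]
    rw [this]
    apply ct_mem
    apply ih
    rw [List.length_cons] at hx
    convert hx using 2
    omega

lemma cts_eq_ct (l : List (Module.Dual K V)) (a : ℕ) {x : ExteriorAlgebra K V}
    (hx : x ∈ ⋀[K]^(a + l.length) V) (φ : Module.Dual K V) (hφ : φ ∈ l) :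
    ∃ y ∈ ⋀[K]^(a + 1) V, cts l x = ct φ y := by
  induction l generalizing a with
  | nil => simp at hφ
  | cons ψ l ih =>
    have h1 : cts (ψ :: l) x = ct ψ (cts l x) := by simp [cts]
    have hx' : x ∈ ⋀[K]^(a + 1 + l.length) V := by
      rw [List.length_cons] at hx
      convert hx using 2
      omega
    rcases List.mem_cons.1 hφ with rfl | h
    · exact ⟨cts l x, cts_mem l _ hx', h1⟩
    · obtain ⟨y, hy, e⟩ := ih (a + 1) hx' h
      refine ⟨- ct ψ y, neg_mem (ct_mem _ _ hy), ?_⟩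
      rw [h1, e, ct_comm, map_neg]

lemma cts_surj {ι : Type*} (e : ι → V) (f : ι → Module.Dual K V)
    (h1 : ∀ i, f i (e i) = 1) (h0 : ∀ i j, i ≠ j → f i (e j) = 0)
    (l : List ι) (hl : l.Nodup) (a : ℕ) {x : ExteriorAlgebra K V}
    (hx : x ∈ ⋀[K]^a V) (hz : ∀ i ∈ l, ct (f i) x = 0) :
    ∃ y ∈ ⋀[K]^(a + l.length) V, cts (l.map f) y = x := by
  induction l generalizing a x with
  | nil => exact ⟨x, by simpa using hx, by simp [cts]⟩
  | cons m l ih =>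
    rw [List.nodup_cons] at hl
    obtain ⟨y, hy, e'⟩ := ih hl.2 (a + 1) (ι_mul_mem (e m) a hx) (by
      intro i hi
      rw [ct_ι_mul, h0 i m (by rintro rfl; exact hl.1 hi), hz i (List.mem_cons_of_mem _ hi)]
      simp)
    refine ⟨y, ?_, ?_⟩
    · rw [List.length_cons]
      convert hy using 2
      omega
    · have : cts ((m :: l).map f) y = ct (f m) (cts (l.map f) y) := by simp [cts]
      rw [this, e', ct_ι_mul, h1, hz m (by simp)]
      simp

lemma ct_ιMulti_eq_zero (φ : Module.Dual K V) (a : ℕ) (v : Fin a → V)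
    (h : ∀ i, φ (v i) = 0) : ct φ (ExteriorAlgebra.ιMulti K a v) = 0 := by
  cases a with
  | zero => simp [ct_one]
  | succ a => rw [ct_ιMulti]; simp [h]

end Ext

end

noncomputable section

/-- monomials of degree `e` in three variables -/
abbrev Mon (e : ℕ) : Type := ↥(Finset.finsuppAntidiag (Finset.univ : Finset (Fin 3)) e)

lemma Mon.sum {e : ℕ} (m : Mon e) : m.1 0 + m.1 1 + m.1 2 = e := by
  have := (Finset.mem_finsuppAntidiag.1 m.2).1
  simpa [Fin.sum_univ_three] using this

lemma mon_mem {e : ℕ} (m : Fin 3 →₀ ℕ) (h : m 0 + m 1 + m 2 = e) :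
    m ∈ Finset.finsuppAntidiag (Finset.univ : Finset (Fin 3)) e := by
  rw [Finset.mem_finsuppAntidiag]
  refine ⟨?_, by simp⟩
  change ∑ i, m i = e
  simpa [Fin.sum_univ_three] using h

/-- the pure power `x_j^d` -/
def pureMon (d : ℕ) (j : Fin 3) : Mon d :=
  ⟨Finsupp.single j d, mon_mem _ (by fin_cases j <;> simp)⟩

/-- exponent vectors with integer entries -/
abbrev GG : Type := Fin 3 → ℤ

/-- natural exponents as integer exponents -/
def emb (m : Fin 3 →₀ ℕ) : GG := fun i => (m i : ℤ)

section Cech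

variable {K : Type*} [Field K] {V : Type*} [AddCommGroup V] [Module K V] {d : ℕ}

/-- the Koszul differential on functions on the exponent lattice -/
def DD (f : Mon d → Module.Dual K V) :
    (GG → ExteriorAlgebra K V) →ₗ[K] (GG → ExteriorAlgebra K V) where
  toFun u c := ∑ m : Mon d, ct (f m) (u (c - emb m.1))
  map_add' u v := by
    ext c
    simp [Finset.sum_add_distrib]
  map_smul' r u := by
    ext c
    simp [Finset.smul_sum]

lemma DD_apply (f : Mon d → Module.Dual K V) (u : GG → ExteriorAlgebra K V) (c : GG) :
    DD f u c = ∑ m : Mon d, ct (f m) (u (c - emb m.1)) := rfl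

lemma DD_DD [CharZero K] (f : Mon d → Module.Dual K V) (u : GG → ExteriorAlgebra K V) :
    DD f (DD f u) = 0 := by
  ext c
  have h : DD f (DD f u) c = - DD f (DD f u) c := by
    simp only [DD_apply, map_sum]
    conv_lhs => rw [Finset.sum_comm]
    rw [← Finset.sum_neg_distrib]
    refine Finset.sum_congr rfl fun m _ => ?_
    rw [← Finset.sum_neg_distrib]
    refine Finset.sum_congr rfl fun m' _ => ?_
    rw [ct_comm]
    congr 4
    abel
  have h2 : (2 : K) • DD f (DD f u) c = 0 := by
    rw [two_smul]
    nth_rewrite 2 [h]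
    exact add_neg_cancel _
  exact (smul_eq_zero.1 h2).resolve_left two_ne_zero

/-- the contracting homotopy attached to an invertible monomial -/
def hh (v : V) (b : GG) :
    (GG → ExteriorAlgebra K V) →ₗ[K] (GG → ExteriorAlgebra K V) where
  toFun u c := ExteriorAlgebra.ι K v * u (c + b)
  map_add' u w := by
    ext c
    simp [mul_add]
  map_smul' r u := by
    ext c
    simp

lemma hh_apply (v : V) (b : GG) (u : GG → ExteriorAlgebra K V) (c : GG) :
    hh v b u c = ExteriorAlgebra.ι K v * u (c + b) := rfl

lemma DD_hh (e : Mon d → V) (f : Mon d → Module.Dual K V)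
    (h1 : ∀ i, f i (e i) = 1) (h0 : ∀ i j, i ≠ j → f i (e j) = 0) (m : Mon d)
    (u : GG → ExteriorAlgebra K V) :
    DD f (hh (e m) (emb m.1) u) = u - hh (e m) (emb m.1) (DD f u) := by
  ext c
  simp only [DD_apply, hh_apply, Pi.sub_apply, ct_ι_mul, Finset.sum_sub_distrib, Finset.mul_sum]
  congr 1
  · rw [Finset.sum_eq_single m]
    · rw [h1]; simp
    · intro b _ hb
      rw [h0 b m hb, zero_smul]
    · simp
  · refine Finset.sum_congr rfl fun m' _ => ?_
    congr 3
    abel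

/-- functions with values in `⋀^a`, supported in total degree `k` -/
def Hom (K : Type*) [Field K] (V : Type*) [AddCommGroup V] [Module K V] (a : ℕ) (k : ℤ) :
    Submodule K (GG → ExteriorAlgebra K V) where
  carrier := {u | ∀ c, u c ∈ ⋀[K]^a V ∧ (c 0 + c 1 + c 2 ≠ k → u c = 0)}
  zero_mem' := fun c => by simp
  add_mem' := fun {u v} hu hv c => ⟨add_mem (hu c).1 (hv c).1, fun h => by
    simp [(hu c).2 h, (hv c).2 h]⟩
  smul_mem' := fun r u hu c => ⟨Submodule.smul_mem _ _ (hu c).1, fun h => by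
    simp [(hu c).2 h]⟩

lemma mem_Hom {a : ℕ} {k : ℤ} {u : GG → ExteriorAlgebra K V} :
    u ∈ Hom K V a k ↔ ∀ c, u c ∈ ⋀[K]^a V ∧ (c 0 + c 1 + c 2 ≠ k → u c = 0) := Iff.rfl

/-- functions supported where the `j`-th exponent is nonnegative -/
def Nn (K : Type*) [Field K] (V : Type*) [AddCommGroup V] [Module K V] (j : Fin 3) :
    Submodule K (GG → ExteriorAlgebra K V) where
  carrier := {u | ∀ c, c j < 0 → u c = 0}
  zero_mem' := fun c _ => rfl
  add_mem' := fun {u v} hu hv c h => by simp [hu c h, hv c h]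
  smul_mem' := fun r u hu c h => by simp [hu c h]

lemma mem_Nn {j : Fin 3} {u : GG → ExteriorAlgebra K V} :
    u ∈ Nn K V j ↔ ∀ c, c j < 0 → u c = 0 := Iff.rfl

lemma DD_Nn (f : Mon d → Module.Dual K V) {j : Fin 3} {u : GG → ExteriorAlgebra K V}
    (hu : u ∈ Nn K V j) : DD f u ∈ Nn K V j := by
  intro c hc
  rw [DD_apply]
  refine Finset.sum_eq_zero fun m _ => ?_
  rw [hu _ (by simp only [Pi.sub_apply, emb]; omega), map_zero]

lemma DD_Hom (f : Mon d → Module.Dual K V) {a : ℕ} {k : ℤ} {u : GG → ExteriorAlgebra K V}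
    (hu : u ∈ Hom K V (a + 1) k) : DD f u ∈ Hom K V a (k + d) := by
  intro c
  rw [DD_apply]
  refine ⟨Submodule.sum_mem _ fun m _ => ct_mem _ _ (hu _).1, fun h => ?_⟩
  refine Finset.sum_eq_zero fun m _ => ?_
  rw [(hu _).2 _, map_zero]
  have := m.sum
  simp only [Pi.sub_apply, emb]
  omega

lemma hh_Nn (v : V) (j k : Fin 3) (hjk : j ≠ k) {u : GG → ExteriorAlgebra K V}
    (hu : u ∈ Nn K V k) : hh v (emb (pureMon d j).1) u ∈ Nn K V k := by
  intro c hc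
  rw [hh_apply, hu, mul_zero]
  simpa [emb, pureMon, Finsupp.single_apply, hjk] using hc

lemma hh_Hom (v : V) (m : Mon d) {a : ℕ} {k : ℤ} {u : GG → ExteriorAlgebra K V}
    (hu : u ∈ Hom K V a k) : hh v (emb m.1) u ∈ Hom K V (a + 1) (k - d) := by
  intro c
  rw [hh_apply]
  refine ⟨ι_mul_mem _ _ (hu _).1, fun h => ?_⟩
  rw [(hu _).2 _, mul_zero]
  have := m.sum
  simp only [Pi.add_apply, emb]
  omega

open Classical in
/-- restriction to a set of exponents -/
def cut (A : GG → Prop) (u : GG → ExteriorAlgebra K V) : GG → ExteriorAlgebra K V :=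
  fun c => if A c then u c else 0

lemma cut_Hom (A : GG → Prop) {a : ℕ} {k : ℤ} {u : GG → ExteriorAlgebra K V}
    (hu : u ∈ Hom K V a k) : cut A u ∈ Hom K V a k := by
  intro c
  unfold cut
  split_ifs
  · exact hu c
  · simp

theorem cech [CharZero K] (e : Mon d → V) (f : Mon d → Module.Dual K V)
    (h1 : ∀ i, f i (e i) = 1) (h0 : ∀ i j, i ≠ j → f i (e j) = 0)
    (i : ℕ) (k : ℤ) (z : GG → ExteriorAlgebra K V) (hz : DD f z = 0)
    (hN : ∀ j, z ∈ Nn K V j) (hH : z ∈ Hom K V i k)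
    (hsol : ∀ y ∈ Hom K V (i + 3) (k - d - d - d),
      ∃ u ∈ Hom K V (i + 4) (k - d - d - d - d), ∀ c : GG, c 0 < 0 → c 1 < 0 → c 2 < 0 →
        DD f u c = y c) :
    ∃ g ∈ Hom K V (i + 1) (k - d), (∀ j, g ∈ Nn K V j) ∧ DD f g = z := by
  obtain ⟨H, hHdef⟩ : ∃ H : Fin 3 → (GG → ExteriorAlgebra K V) →ₗ[K] (GG → ExteriorAlgebra K V),
      H = fun j => hh (e (pureMon d j)) (emb (pureMon d j).1) := ⟨_, rfl⟩
  have HD : ∀ j u, DD f (H j u) = u - H j (DD f u) := by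
    intro j u
    rw [hHdef]
    exact DD_hh e f h1 h0 _ u
  have HN : ∀ j k, j ≠ k → ∀ u, u ∈ Nn K V k → H j u ∈ Nn K V k := by
    intro j k hjk u hu
    rw [hHdef]
    exact hh_Nn _ j k hjk hu
  have HH : ∀ j a k u, u ∈ Hom K V a k → H j u ∈ Hom K V (a + 1) (k - d) := by
    intro j a k u hu
    rw [hHdef]
    exact hh_Hom _ _ hu
  have D1 : ∀ j, DD f (H j z) = z := fun j => by rw [HD, hz, map_zero, sub_zero]
  have D2 : ∀ a b, DD f (H a (H b z)) = H b z - H a z := fun a b => by rw [HD, D1]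
  have D3 : DD f (H 0 (H 1 (H 2 z))) = H 1 (H 2 z) - H 0 (H 2 z) + H 0 (H 1 z) := by
    rw [HD, D2, map_sub]; abel
  have z1 : ∀ j, H j z ∈ Hom K V (i + 1) (k - d) := fun j => HH j _ _ _ hH
  have z2 : ∀ a b, H a (H b z) ∈ Hom K V (i + 2) (k - d - d) := fun a b => HH a _ _ _ (z1 b)
  have z3 : H 0 (H 1 (H 2 z)) ∈ Hom K V (i + 3) (k - d - d - d) := HH 0 _ _ _ (z2 1 2)
  obtain ⟨u, huH, hu⟩ := hsol _ z3
  obtain ⟨y, hy⟩ : ∃ y, y = H 0 (H 1 (H 2 z)) - DD f u := ⟨_, rfl⟩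
  have hyH : y ∈ Hom K V (i + 3) (k - d - d - d) := by
    rw [hy]
    refine sub_mem z3 ?_
    have := DD_Hom f huH
    rwa [sub_add_cancel] at this
  have hyneg : ∀ c : GG, c 0 < 0 → c 1 < 0 → c 2 < 0 → y c = 0 := by
    intro c a0 a1 a2
    rw [hy, Pi.sub_apply, hu c a0 a1 a2, sub_self]
  have hDy : DD f y = H 1 (H 2 z) - H 0 (H 2 z) + H 0 (H 1 z) := by
    rw [hy, map_sub, DD_DD, D3, sub_zero]
  obtain ⟨y12, hy12⟩ : ∃ w, w = cut (fun c => 0 ≤ c 0) y := ⟨_, rfl⟩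
  obtain ⟨y02, hy02⟩ : ∃ w, w = cut (fun c => c 0 < 0 ∧ 0 ≤ c 1) y := ⟨_, rfl⟩
  obtain ⟨y01, hy01⟩ : ∃ w, w = cut (fun c => c 0 < 0 ∧ c 1 < 0 ∧ 0 ≤ c 2) y := ⟨_, rfl⟩
  have ysum : y = y12 + y02 + y01 := by
    ext c
    rw [hy12, hy02, hy01]
    simp only [cut, Pi.add_apply]
    have := hyneg c
    by_cases a0 : 0 ≤ c 0
    · simp [a0, not_lt.2 a0]
    · by_cases a1 : 0 ≤ c 1
      · simp [a0, a1, not_le.1 a0, not_lt.2 a1]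
      · by_cases a2 : 0 ≤ c 2
        · simp [a0, a1, a2, not_le.1 a0, not_le.1 a1]
        · rw [this (not_le.1 a0) (not_le.1 a1) (not_le.1 a2)]
          simp
  have y12N : y12 ∈ Nn K V 0 := by
    intro c hc
    rw [hy12]
    simp only [cut]
    rw [if_neg (by omega)]
  have y02N : y02 ∈ Nn K V 1 := by
    intro c hc
    rw [hy02]
    simp only [cut]
    rw [if_neg (by omega)]
  have y01N : y01 ∈ Nn K V 2 := by
    intro c hc
    rw [hy01]
    simp only [cut]
    rw [if_neg (by omega)]
  have DyH : ∀ w ∈ Hom K V (i + 3) (k - d - d - d), DD f w ∈ Hom K V (i + 2) (k - d - d) := by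
    intro w hw
    have := DD_Hom f hw
    rwa [sub_add_cancel] at this
  obtain ⟨t12, ht12⟩ : ∃ w, w = H 1 (H 2 z) - DD f y12 := ⟨_, rfl⟩
  obtain ⟨t02, ht02⟩ : ∃ w, w = H 0 (H 2 z) + DD f y02 := ⟨_, rfl⟩
  obtain ⟨t01, ht01⟩ : ∃ w, w = H 0 (H 1 z) - DD f y01 := ⟨_, rfl⟩
  have tsum : t12 - t02 + t01 = 0 := by
    rw [ysum, map_add, map_add] at hDy
    rw [ht12, ht02, ht01]
    have : H 1 (H 2 z) - DD f y12 - (H 0 (H 2 z) + DD f y02) + (H 0 (H 1 z) - DD f y01)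
      = (H 1 (H 2 z) - H 0 (H 2 z) + H 0 (H 1 z)) - (DD f y12 + DD f y02 + DD f y01) := by abel
    rw [this, hDy, sub_self]
  have t12H : t12 ∈ Hom K V (i + 2) (k - d - d) := by
    rw [ht12]
    exact sub_mem (z2 _ _) (DyH _ (hy12 ▸ cut_Hom _ hyH))
  have t12N : t12 ∈ Nn K V 0 := by
    rw [ht12]
    exact sub_mem (HN _ _ (by decide) _ (HN _ _ (by decide) _ (hN 0))) (DD_Nn f y12N)
  have t02N : t02 ∈ Nn K V 1 := by
    rw [ht02]
    exact add_mem (HN _ _ (by decide) _ (HN _ _ (by decide) _ (hN 1))) (DD_Nn f y02N)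
  have t01N : t01 ∈ Nn K V 2 := by
    rw [ht01]
    exact sub_mem (HN _ _ (by decide) _ (HN _ _ (by decide) _ (hN 2))) (DD_Nn f y01N)
  have Dt12 : DD f t12 = H 2 z - H 1 z := by
    rw [ht12, map_sub, DD_DD, D2, sub_zero]
  have Dt02 : DD f t02 = H 2 z - H 0 z := by
    rw [ht02, map_add, DD_DD, D2, add_zero]
  have tc : ∀ c, t12 c - t02 c + t01 c = 0 := fun c => congrFun tsum c
  obtain ⟨s2, hs2⟩ : ∃ w, w = cut (fun c => 0 ≤ c 1) t12 := ⟨_, rfl⟩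
  have s2H : s2 ∈ Hom K V (i + 2) (k - d - d) := by
    rw [hs2]
    exact cut_Hom _ t12H
  have s2N0 : s2 ∈ Nn K V 0 := by
    intro c hc
    rw [hs2]
    simp only [cut]
    rw [t12N c hc, ite_self]
  have s2N1 : s2 ∈ Nn K V 1 := by
    intro c hc
    rw [hs2]
    simp only [cut]
    rw [if_neg (by omega)]
  have s1N2 : s2 - t12 ∈ Nn K V 2 := by
    intro c hc
    rw [hs2, Pi.sub_apply]
    simp only [cut]
    split_ifs with h
    · simp
    · have h3 := tc c
      rw [t02N c (not_le.1 h), t01N c hc] at h3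
      simpa using h3
  refine ⟨H 2 z - DD f s2, ?_, ?_, ?_⟩
  · refine sub_mem (z1 2) ?_
    have := DD_Hom f s2H
    rwa [sub_add_cancel] at this
  · intro j
    fin_cases j
    · exact sub_mem (HN _ _ (by decide) _ (hN 0)) (DD_Nn f s2N0)
    · exact sub_mem (HN _ _ (by decide) _ (hN 1)) (DD_Nn f s2N1)
    · have e1 : H 2 z - DD f s2 = H 1 z - DD f (s2 - t12) := by
        rw [map_sub, Dt12]; abel
      rw [e1]
      exact sub_mem (HN _ _ (by decide) _ (hN 2)) (DD_Nn f s1N2)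
  · rw [map_sub, DD_DD, D1, sub_zero]

end Cech

end

noncomputable section

section Green

variable {K : Type*} [Field K] {V : Type*} [AddCommGroup V] [Module K V] {d : ℕ}

/-- value of a monomial at a point -/
def pm (p : Fin 3 → K) (m : Fin 3 → ℕ) : K := ∏ i, p i ^ m i

lemma pm_add (p : Fin 3 → K) (m m' : Fin 3 → ℕ) :
    pm p (fun i => m i + m' i) = pm p m * pm p m' := by
  simp [pm, pow_add, Finset.prod_mul_distrib]

/-- evaluation at a point as a linear form -/
def evp (f : Mon d → Module.Dual K V) (p : Fin 3 → K) : Module.Dual K V :=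
  ∑ m : Mon d, pm p m.1 • f m

/-- the negative exponent dual to `a` -/
def ng (a : Fin 3 →₀ ℕ) : GG := fun i => -1 - (a i : ℤ)

/-- the image of the Koszul differential in the top local cohomology -/
def Img (f : Mon d → Module.Dual K V) (k : ℕ) : Submodule K (Mon (d - 3) → ExteriorAlgebra K V) :=
  (Hom K V (k + 1) (-(d : ℤ) - d)).map
    ((LinearMap.funLeft K (ExteriorAlgebra K V) (fun a : Mon (d - 3) => ng a.1)) ∘ₗ DD f)

lemma mem_Img_of_point (hd : 3 ≤ d) (f : Mon d → Module.Dual K V) (k : ℕ) (p : Fin 3 → K)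
    (ω : ExteriorAlgebra K V) (hω : ω ∈ ⋀[K]^(k + 1) V) :
    (fun a : Mon (d - 3) => pm p a.1 • ct (evp f p) ω) ∈ Img f k := by
  classical
  refine Submodule.mem_map.2 ⟨fun c => if c 0 + c 1 + c 2 = -(d : ℤ) - d then
    pm p (fun i => (-1 - c i).toNat) • ω else 0, ?_, ?_⟩
  · intro c
    refine ⟨?_, fun h => if_neg h⟩
    dsimp only
    split_ifs
    · exact Submodule.smul_mem _ _ hω
    · exact zero_mem _
  · ext a
    simp only [LinearMap.comp_apply, LinearMap.funLeft_apply, DD_apply]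
    have : ∀ m : Mon d, (ng a.1 - emb m.1) 0 + (ng a.1 - emb m.1) 1 + (ng a.1 - emb m.1) 2
        = -(d : ℤ) - d := by
      intro m
      have h1 := a.sum
      have h2 := m.sum
      simp only [Pi.sub_apply, ng, emb]
      omega
    have h2 : ∀ m : Mon d, pm p (fun i => (-1 - (ng a.1 - emb m.1) i).toNat)
        = pm p a.1 * pm p m.1 := by
      intro m
      rw [← pm_add]
      congr 1
      ext i
      simp only [Pi.sub_apply, ng, emb]
      omega
    simp only [this, if_true, h2, map_smul]
    rw [evp, ct_sum, LinearMap.sum_apply, Finset.smul_sum]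
    refine Finset.sum_congr rfl fun m _ => ?_
    rw [LinearMap.smul_apply, mul_smul]

/-- the evaluation matrix -/
def evm {w : ℕ} {e : ℕ} (q : Fin w ≃ Mon e) (p : Fin w → Fin 3 → K) : Matrix (Fin w) (Fin w) K :=
  Matrix.of fun j l => pm (p j) (q l).1

lemma single_mem_Img (hd : 3 ≤ d) (f : Mon d → Module.Dual K V) (k : ℕ) {w : ℕ}
    (q : Fin w ≃ Mon (d - 3)) (p : Fin w → Fin 3 → K) (hp : (evm q p).det ≠ 0)
    (η : ExteriorAlgebra K V)
    (hη : ∀ j, ∃ ω ∈ ⋀[K]^(k + 1) V, η = ct (evp f (p j)) ω) (l₀ : Fin w) :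
    (Pi.single (q l₀) η : Mon (d - 3) → ExteriorAlgebra K V) ∈ Img f k := by
  classical
  have key : (Pi.single (q l₀) η : Mon (d - 3) → ExteriorAlgebra K V) =
      ∑ j, ((evm q p)⁻¹ l₀ j) • (fun a : Mon (d - 3) => pm (p j) a.1 • η) := by
    ext a
    obtain ⟨l, rfl⟩ := q.surjective a
    have h := congrFun (congrFun (Matrix.nonsing_inv_mul (evm q p) (isUnit_iff_ne_zero.2 hp)) l₀) l
    rw [Matrix.mul_apply] at h
    simp only [Finset.sum_apply, Pi.smul_apply, smul_smul, ← Finset.sum_smul]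
    have h' : ∑ j, (evm q p)⁻¹ l₀ j * pm (p j) (q l).1 = (1 : Matrix (Fin w) (Fin w) K) l₀ l := h
    rw [h', Matrix.one_apply, Pi.single_apply]
    simp only [q.injective.eq_iff, eq_comm (a := l)]
    split_ifs <;> simp
  rw [key]
  refine Submodule.sum_mem _ fun j _ => Submodule.smul_mem _ _ ?_
  obtain ⟨ω, hω, e⟩ := hη j
  rw [e]
  exact mem_Img_of_point hd f k (p j) ω hω

lemma exists_points [CharZero K] {w e : ℕ} (q : Fin w ≃ Mon e) :
    ∃ p : Fin w → Fin 3 → K, (evm q p).det ≠ 0 := by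
  refine ⟨fun j => ![1, 2 ^ (j : ℕ), 2 ^ ((e + 1) * (j : ℕ))], ?_⟩
  have : evm q (fun j : Fin w => ![(1 : K), 2 ^ (j : ℕ), 2 ^ ((e + 1) * (j : ℕ))]) =
      (Matrix.vandermonde fun l => (2 : K) ^ ((q l).1 1 + (e + 1) * (q l).1 2)).transpose := by
    ext j l
    simp only [evm, Matrix.of_apply, pm, Fin.prod_univ_three, Matrix.transpose_apply,
      Matrix.vandermonde_apply]
    simp only [Matrix.cons_val_zero, Matrix.cons_val_one, Matrix.cons_val, one_pow, one_mul,
      ← pow_mul, ← pow_add]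
    congr 1
    ring
  rw [this, Matrix.det_transpose, Matrix.det_vandermonde_ne_zero_iff]
  intro l l' h
  have h2 : (2 : ℕ) ^ ((q l).1 1 + (e + 1) * (q l).1 2) =
      2 ^ ((q l').1 1 + (e + 1) * (q l').1 2) := by
    dsimp only at h
    exact_mod_cast h
  have h3 := Nat.pow_right_injective le_rfl h2
  have s1 := (q l).sum
  have s2 := (q l').sum
  have l1 : (q l).1 1 < e + 1 := by omega
  have l2 : (q l').1 1 < e + 1 := by omega
  have e1 : (q l).1 1 = (q l').1 1 := by
    have := congrArg (· % (e + 1)) h3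
    simpa [Nat.add_mul_mod_self_left, Nat.mod_eq_of_lt l1, Nat.mod_eq_of_lt l2] using this
  have e2 : (q l).1 2 = (q l').1 2 := by
    rw [e1] at h3
    exact Nat.eq_of_mul_eq_mul_left (Nat.succ_pos e) (Nat.add_left_cancel h3)
  apply q.injective
  apply Subtype.ext
  ext i
  fin_cases i
  · change (q l).1 0 = (q l').1 0
    omega
  · exact e1
  · exact e2

lemma cts_evp {w : ℕ} (f : Mon d → Module.Dual K V) (p : Fin w → Fin 3 → K) :
    cts (List.ofFn fun j => evp f (p j)) =
      ∑ μ : Fin w → Mon d, (∏ j, pm (p j) (μ j).1) • cts (List.ofFn fun j => f (μ j)) := by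
  classical
  have h : ∀ g : Fin w → Module.Dual K V, cts (List.ofFn g) =
      MultilinearMap.mkPiAlgebraFin K w (Module.End K (ExteriorAlgebra K V)) (fun j => ct (g j)) := by
    intro g
    rw [MultilinearMap.mkPiAlgebraFin_apply, cts, List.map_ofFn]
    rfl
  simp only [h]
  simp only [evp, ct_sum]
  rw [MultilinearMap.map_sum]
  refine Finset.sum_congr rfl fun μ _ => ?_
  rw [MultilinearMap.map_smul_univ]

lemma poly_vanish [CharZero K] {w e : ℕ} (q : Fin w ≃ Mon e) (F : (Fin w → Mon d) → K)
    (h : ∀ p : Fin w → Fin 3 → K, (evm q p).det ≠ 0 →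
      ∑ μ : Fin w → Mon d, (∏ j, pm (p j) (μ j).1) * F μ = 0) (μ₀ : Fin w → Mon d) :
    F μ₀ = 0 := by
  classical
  let ex : (Fin w → Mon d) → (Fin w × Fin 3 →₀ ℕ) := fun μ =>
    Finsupp.equivFunOnFinite.symm (fun t => (μ t.1).1 t.2)
  have exinj : Function.Injective ex := by
    intro μ ν hμ
    ext j i
    have := DFunLike.congr_fun hμ (j, i)
    simpa [ex] using this
  let Q : MvPolynomial (Fin w × Fin 3) K := ∑ μ, MvPolynomial.monomial (ex μ) (F μ)
  let M : Matrix (Fin w) (Fin w) (MvPolynomial (Fin w × Fin 3) K) :=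
    Matrix.of fun j l => ∏ i, MvPolynomial.X (j, i) ^ ((q l).1 i)
  have hQ : ∀ x : Fin w × Fin 3 → K, MvPolynomial.eval x Q =
      ∑ μ : Fin w → Mon d, (∏ j, pm (fun i => x (j, i)) (μ j).1) * F μ := by
    intro x
    simp only [Q, map_sum, MvPolynomial.eval_monomial]
    refine Finset.sum_congr rfl fun μ _ => ?_
    rw [mul_comm, Finsupp.prod_fintype _ _ (by simp)]
    congr 1
    rw [Fintype.prod_prod_type]
    rfl
  have hM : ∀ x : Fin w × Fin 3 → K, MvPolynomial.eval x M.det =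
      (evm q (fun j i => x (j, i))).det := by
    intro x
    rw [RingHom.map_det]
    congr 1
    ext j l
    simp [M, evm, pm]
  have hMne : M.det ≠ 0 := by
    intro h0
    obtain ⟨p, hp⟩ := exists_points (K := K) q
    apply hp
    have := hM (fun t => p t.1 t.2)
    rw [h0, map_zero] at this
    exact this.symm
  have hprod : M.det * Q = 0 := by
    apply MvPolynomial.funext
    intro x
    rw [map_mul, hM, hQ, map_zero]
    by_cases hx : (evm q (fun j i => x (j, i))).det = 0
    · rw [hx, zero_mul]
    · rw [h _ hx, mul_zero]
  have hQ0 : Q = 0 := (mul_eq_zero.1 hprod).resolve_left hMne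
  have := congrArg (MvPolynomial.coeff (ex μ₀)) hQ0
  simpa [Q, MvPolynomial.coeff_sum, MvPolynomial.coeff_monomial, exinj.eq_iff] using this

lemma card_Mon (e : ℕ) : Fintype.card (Mon e) = (e + 2).choose 2 := by
  rw [Fintype.card_coe, Finset.card_finsuppAntidiag_nat_eq_choose]
  rw [Finset.card_univ, Fintype.card_fin]
  rw [show 3 + e - 1 = e + 2 by omega]
  exact Nat.choose_symm_add

lemma card_diff (hd : 3 ≤ d) : Fintype.card (Mon d) = Fintype.card (Mon (d - 3)) + 3 * d := by
  obtain ⟨c, rfl⟩ := Nat.exists_eq_add_of_le hd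
  rw [card_Mon, card_Mon]
  have e1 : 3 + c - 3 + 2 = c + 2 := by omega
  have e2 : 3 + c + 2 = c + 2 + 1 + 1 + 1 := by omega
  rw [e1, e2]
  simp only [Nat.choose_succ_succ' _ 1, Nat.choose_one_right]
  omega

theorem green [CharZero K] (hd : 3 ≤ d) (e : Mon d → V) (f : Mon d → Module.Dual K V)
    (h1 : ∀ i, f i (e i) = 1) (h0 : ∀ i j, i ≠ j → f i (e j) = 0)
    (hspan : Submodule.span K (Set.range e) = ⊤) (k : ℕ) (hk : k ≤ 3 * d)
    (y : GG → ExteriorAlgebra K V) (hy : y ∈ Hom K V k (-(d : ℤ))) :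
    ∃ u ∈ Hom K V (k + 1) (-(d : ℤ) - d), ∀ c : GG, c 0 < 0 → c 1 < 0 → c 2 < 0 →
        DD f u c = y c := by
  classical
  obtain ⟨w, hw⟩ : ∃ w, w = Fintype.card (Mon (d - 3)) := ⟨_, rfl⟩
  have q : Fin w ≃ Mon (d - 3) := (Fintype.equivFinOfCardEq hw.symm).symm
  -- step 1: iterated contractions
  have step1 : ∀ (μ₀ : Fin w → Mon d) (Ω : ExteriorAlgebra K V), Ω ∈ ⋀[K]^(k + w) V →
      ∀ a, (Pi.single a (cts (List.ofFn fun j => f (μ₀ j)) Ω) :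
        Mon (d - 3) → ExteriorAlgebra K V) ∈ Img f k := by
    intro μ₀ Ω hΩ a
    by_contra hcon
    obtain ⟨L, hL1, hL2⟩ := Submodule.exists_le_ker_of_notMem hcon
    apply hL1
    let L' : ExteriorAlgebra K V →ₗ[K] K :=
      L ∘ₗ LinearMap.single K (fun _ : Mon (d - 3) => ExteriorAlgebra K V) a
    refine poly_vanish q (fun μ => L' (cts (List.ofFn fun j => f (μ j)) Ω)) ?_ μ₀
    intro p hp
    have hin : (Pi.single a (cts (List.ofFn fun j => evp f (p j)) Ω) :
        Mon (d - 3) → ExteriorAlgebra K V) ∈ Img f k := by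
      obtain ⟨l₀, rfl⟩ := q.surjective a
      refine single_mem_Img hd f k q p hp _ (fun j => ?_) l₀
      refine cts_eq_ct _ k (by simpa using hΩ) _ ?_
      rw [List.mem_ofFn]
      exact ⟨j, rfl⟩
    have h3 : L' (cts (List.ofFn fun j => evp f (p j)) Ω) = 0 := hL2 hin
    rw [cts_evp, LinearMap.sum_apply, map_sum] at h3
    rw [← h3]
    refine Finset.sum_congr rfl fun μ _ => ?_
    rw [LinearMap.smul_apply, map_smul, smul_eq_mul]
  -- step 2: everything is an iterated contraction
  have step2 : ∀ x ∈ ⋀[K]^k V, ∀ a, (Pi.single a x : Mon (d - 3) → ExteriorAlgebra K V) ∈ Img f k := by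
    intro x hx a
    rw [← exteriorPower.ιMulti_span_fixedDegree_of_span_eq_top K k V hspan] at hx
    induction hx using Submodule.span_induction with
    | mem x hx =>
      obtain ⟨v, hv, rfl⟩ := hx
      have hv' : ∀ i, ∃ m, e m = v i := fun i => hv ⟨i, rfl⟩
      choose m hm using hv'
      have hcard : w ≤ ((Finset.univ.image m)ᶜ).card := by
        rw [Finset.card_compl, card_diff hd, ← hw]
        have := Finset.card_image_le (s := Finset.univ) (f := m)
        rw [Finset.card_univ, Fintype.card_fin] at this
        omega
      obtain ⟨T, hT, hTc⟩ := Finset.exists_subset_card_eq hcard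
      obtain ⟨Ω, hΩ, hΩe⟩ := cts_surj e f h1 h0 T.toList T.nodup_toList k
        (x := ExteriorAlgebra.ιMulti K k v) (ExteriorAlgebra.ιMulti_range K k ⟨v, rfl⟩) (by
          intro i hi
          apply ct_ιMulti_eq_zero
          intro l
          rw [← hm l]
          apply h0
          rintro rfl
          have := hT (Finset.mem_toList.1 hi)
          simp at this)
      have hlen : T.toList.length = w := by rw [Finset.length_toList, hTc]
      rw [hlen] at hΩ
      rw [← hΩe]
      have hl : T.toList.map f = List.ofFn (fun j : Fin w => f (T.toList.get (j.cast hlen.symm))) := by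
        apply List.ext_get
        · simp [hTc]
        · intro n _ _
          simp
      rw [hl]
      exact step1 _ Ω hΩ a
    | zero => rw [Pi.single_zero]; exact zero_mem _
    | add x y _ _ hx hy => rw [Pi.single_add]; exact add_mem hx hy
    | smul c x _ hx => rw [Pi.single_smul]; exact Submodule.smul_mem _ _ hx
  have step3 : (fun a : Mon (d - 3) => y (ng a.1)) ∈ Img f k := by
    rw [← Finset.univ_sum_single (fun a : Mon (d - 3) => y (ng a.1))]
    exact Submodule.sum_mem _ fun a _ => step2 _ (hy _).1 a
  obtain ⟨u, hu, hue⟩ := Submodule.mem_map.1 step3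
  refine ⟨u, hu, fun c c0 c1 c2 => ?_⟩
  by_cases hc : c 0 + c 1 + c 2 = -(d : ℤ)
  · let a0 : Fin 3 →₀ ℕ := Finsupp.equivFunOnFinite.symm (fun i => (-1 - c i).toNat)
    have ha : a0 0 + a0 1 + a0 2 = d - 3 := by
      simp only [a0, Finsupp.equivFunOnFinite_symm_apply_apply]
      omega
    have hca : ng a0 = c := by
      ext i
      simp only [a0, ng, Finsupp.equivFunOnFinite_symm_apply_apply]
      fin_cases i <;> simp <;> omega
    have := congrFun hue ⟨a0, mon_mem _ ha⟩
    simp only [LinearMap.comp_apply, LinearMap.funLeft_apply, hca] at this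
    exact this
  · rw [(hy c).2 hc]
    have := DD_Hom f hu
    rw [sub_add_cancel] at this
    exact (this c).2 hc

end Green

end

noncomputable section

section Bridge

variable {K : Type*} [Field K]

/-- the monomial basis of the space of forms -/
def xm {b : ℕ} (m : Mon b) : S K 2 b :=
  ⟨MvPolynomial.monomial m.1 1, by
    rw [MvPolynomial.mem_homogeneousSubmodule]
    apply MvPolynomial.isHomogeneous_monomial
    have := m.sum
    simpa [Finsupp.degree_eq_sum, Fin.sum_univ_three] using this⟩

/-- the dual basis -/
def cf {b : ℕ} (m : Mon b) : Module.Dual K (S K 2 b) :=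
  MvPolynomial.lcoeff K m.1 ∘ₗ (S K 2 b).subtype

lemma cf_apply {b : ℕ} (m : Mon b) (s : S K 2 b) : cf m s = MvPolynomial.coeff m.1 s.1 := rfl

lemma cf_xm_self {b : ℕ} (m : Mon b) : cf (K := K) m (xm m) = 1 := by
  simp [cf_apply, xm]

lemma cf_xm_ne {b : ℕ} (m m' : Mon b) (h : m ≠ m') : cf (K := K) m (xm m') = 0 := by
  rw [cf_apply, xm, MvPolynomial.coeff_monomial, if_neg]
  intro h'
  exact h (Subtype.ext h'.symm)

lemma form_sum {b : ℕ} (s : S K 2 b) : s = ∑ m : Mon b, cf m s • xm m := by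
  apply Subtype.ext
  ext n
  rw [Submodule.coe_sum, MvPolynomial.coeff_sum]
  simp only [Submodule.coe_smul, xm, MvPolynomial.coeff_smul, MvPolynomial.coeff_monomial,
    smul_eq_mul, cf_apply]
  by_cases hn : n 0 + n 1 + n 2 = b
  · rw [Finset.sum_eq_single ⟨n, mon_mem n hn⟩]
    · simp
    · intro m _ hm
      rw [if_neg, mul_zero]
      intro h
      exact hm (Subtype.ext h)
    · simp
  · rw [Finset.sum_eq_zero]
    · have hs := (MvPolynomial.mem_homogeneousSubmodule _ _).1 s.2
      apply hs.coeff_eq_zero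
      rw [Finsupp.degree_eq_sum]
      simpa [Fin.sum_univ_three] using hn
    · intro m _
      rw [if_neg, mul_zero]
      rintro rfl
      exact hn m.sum

lemma xm_span (b : ℕ) : Submodule.span K (Set.range (xm (K := K) (b := b))) = ⊤ := by
  rw [eq_top_iff]
  intro s _
  rw [form_sum s]
  exact Submodule.sum_mem _ fun m _ => Submodule.smul_mem _ _ (Submodule.subset_span ⟨m, rfl⟩)

/-- truncation of an integer exponent vector -/
def natz (c : GG) : Fin 3 →₀ ℕ := Finsupp.equivFunOnFinite.symm (fun i => (c i).toNat)

/-- the coefficient at an integer exponent -/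
def cZ (c : GG) : MvPolynomial (Fin (2 + 1)) K →ₗ[K] K :=
  if ∀ i, 0 ≤ c i then MvPolynomial.lcoeff K (natz c) else 0

lemma natz_emb (m : Fin 3 →₀ ℕ) : natz (emb m) = m := by
  ext i
  simp [natz, emb]

lemma cZ_emb (m : Fin 3 →₀ ℕ) (w : MvPolynomial (Fin (2 + 1)) K) :
    cZ (emb m) w = MvPolynomial.coeff m w := by
  rw [cZ, if_pos (by intro i; simp [emb]), natz_emb]
  rfl

lemma cZ_mul_monomial (c : GG) (m : Fin 3 →₀ ℕ) (w : MvPolynomial (Fin (2 + 1)) K) :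
    cZ c (MvPolynomial.monomial m 1 * w) = cZ (c - emb m) w := by
  unfold cZ
  by_cases h : ∀ i, 0 ≤ c i
  · rw [if_pos h]
    change MvPolynomial.coeff (natz c) _ = _
    rw [MvPolynomial.coeff_monomial_mul']
    by_cases h2 : m ≤ natz c
    · have h3 : ∀ i, (m i : ℤ) ≤ c i := by
        intro i
        have := h2 i
        have := h i
        simp only [natz, Finsupp.equivFunOnFinite_symm_apply_apply] at *
        omega
      rw [if_pos h2, if_pos (by intro i; have := h3 i; simp only [Pi.sub_apply, emb]; omega), one_mul]
      change _ = MvPolynomial.coeff (natz (c - emb m)) _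
      congr 1
      ext i
      simp only [natz, emb, Finsupp.equivFunOnFinite_symm_apply_apply, Finsupp.tsub_apply,
        Pi.sub_apply]
      omega
    · rw [if_neg h2, if_neg]
      · rfl
      · intro h3
        apply h2
        intro i
        have := h3 i
        simp only [natz, emb, Finsupp.equivFunOnFinite_symm_apply_apply, Pi.sub_apply] at *
        omega
  · rw [if_neg h, if_neg]
    · rfl
    · intro h3
      apply h
      intro i
      have := h3 i
      simp only [emb, Pi.sub_apply] at this
      omega

lemma cZ_mul {d : ℕ} (c : GG) (s : S K 2 d) (w : MvPolynomial (Fin (2 + 1)) K) :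
    cZ c (s.1 * w) = ∑ m : Mon d, cf m s * cZ (c - emb m.1) w := by
  conv_lhs => rw [form_sum s]
  rw [Submodule.coe_sum, Finset.sum_mul, map_sum]
  refine Finset.sum_congr rfl fun m _ => ?_
  rw [Submodule.coe_smul, smul_mul_assoc, map_smul, smul_eq_mul]
  congr 1
  exact cZ_mul_monomial c m.1 w

/-- tensors as functions on the exponent lattice -/
def Ph (V : Type*) [AddCommGroup V] [Module K V] (a b : ℕ) :
    ((⋀[K]^a V) ⊗[K] (S K 2 b)) →ₗ[K] (GG → ExteriorAlgebra K V) :=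
  TensorProduct.lift (LinearMap.mk₂ K (fun ω w c => cZ c w.1 • ω.1)
    (by intro x y w; ext c; simp)
    (by intro r x w; ext c; exact smul_comm _ _ _)
    (by intro x w w'; ext c; simp [add_smul])
    (by intro r x w; ext c; simp [mul_smul]))

section

variable {V : Type*} [AddCommGroup V] [Module K V]

lemma Ph_tmul (a b : ℕ) (ω : ⋀[K]^a V) (w : S K 2 b) (c : GG) :
    Ph V a b (ω ⊗ₜ w) c = cZ c w.1 • ω.1 := rfl

lemma exists_rep (a b : ℕ) (t : (⋀[K]^a V) ⊗[K] (S K 2 b)) :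
    ∃ ω : Mon b → ⋀[K]^a V, t = ∑ m, ω m ⊗ₜ xm m := by
  induction t with
  | zero => exact ⟨0, by simp⟩
  | tmul x w =>
    refine ⟨fun m => cf m w • x, ?_⟩
    conv_lhs => rw [form_sum w]
    rw [TensorProduct.tmul_sum]
    refine Finset.sum_congr rfl fun m _ => ?_
    rw [TensorProduct.smul_tmul]
  | add x y hx hy =>
    obtain ⟨u, hu⟩ := hx
    obtain ⟨v, hv⟩ := hy
    refine ⟨u + v, ?_⟩
    rw [hu, hv, ← Finset.sum_add_distrib]
    refine Finset.sum_congr rfl fun m _ => ?_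
    rw [Pi.add_apply, TensorProduct.add_tmul]

lemma Ph_rep (a b : ℕ) (ω : Mon b → ⋀[K]^a V) (m : Mon b) :
    Ph V a b (∑ m, ω m ⊗ₜ xm m) (emb m.1) = (ω m).1 := by
  rw [map_sum, Finset.sum_apply]
  simp only [Ph_tmul, cZ_emb]
  have h : ∀ m' : Mon b, MvPolynomial.coeff m.1 (xm (K := K) m').1 = cf m (xm m') := fun _ => rfl
  simp only [h]
  rw [Finset.sum_eq_single m]
  · rw [cf_xm_self, one_smul]
  · intro m' _ h'
    rw [cf_xm_ne m m' h'.symm, zero_smul]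
  · simp

lemma Ph_injective (a b : ℕ) : Function.Injective (Ph (K := K) V a b) := by
  rw [injective_iff_map_eq_zero]
  intro t ht
  obtain ⟨ω, rfl⟩ := exists_rep a b t
  refine Finset.sum_eq_zero fun m _ => ?_
  have := Ph_rep a b ω m
  rw [ht] at this
  have h : ω m = 0 := Subtype.ext this.symm
  rw [h, TensorProduct.zero_tmul]

lemma cZ_eq_zero {b : ℕ} (w : S K 2 b) (c : GG) (h : c 0 + c 1 + c 2 ≠ b) : cZ c w.1 = 0 := by
  unfold cZ
  split_ifs with h2
  · have hs := (MvPolynomial.mem_homogeneousSubmodule _ _).1 w.2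
    apply hs.coeff_eq_zero
    rw [Finsupp.degree_eq_sum]
    have a0 := h2 0
    have a1 := h2 1
    have a2 := h2 2
    have hsum : ∑ i : Fin 3, natz c i = (c 0).toNat + (c 1).toNat + (c 2).toNat := by
      rw [Fin.sum_univ_three]
      rfl
    refine fun h3 => ?_
    have h4 := hsum.symm.trans h3
    omega
  · rfl

lemma Ph_Hom (a b : ℕ) (t : (⋀[K]^a V) ⊗[K] (S K 2 b)) : Ph V a b t ∈ Hom K V a b := by
  induction t with
  | zero => rw [map_zero]; exact zero_mem _
  | add x y hx hy => rw [map_add]; exact add_mem hx hy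
  | tmul x w =>
    intro c
    rw [Ph_tmul]
    refine ⟨Submodule.smul_mem _ _ x.2, fun h => ?_⟩
    rw [cZ_eq_zero w c h, zero_smul]

lemma Ph_Nn (a b : ℕ) (t : (⋀[K]^a V) ⊗[K] (S K 2 b)) (j : Fin 3) : Ph V a b t ∈ Nn K V j := by
  induction t with
  | zero => rw [map_zero]; exact zero_mem _
  | add x y hx hy => rw [map_add]; exact add_mem hx hy
  | tmul x w =>
    intro c hc
    rw [Ph_tmul, cZ, if_neg (by intro h; have := h j; omega)]
    simp

lemma Ph_surj (a b : ℕ) (g : GG → ExteriorAlgebra K V) (hg : g ∈ Hom K V a b)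
    (hN : ∀ j, g ∈ Nn K V j) : ∃ t, Ph V a b t = g := by
  refine ⟨∑ m : Mon b, (⟨g (emb m.1), (hg _).1⟩ : ⋀[K]^a V) ⊗ₜ xm m, ?_⟩
  ext c
  by_cases h : ∀ i, 0 ≤ c i
  · have hc : emb (natz c) = c := by
      ext i
      have := h i
      simp only [natz, emb, Finsupp.equivFunOnFinite_symm_apply_apply]
      omega
    by_cases hb : c 0 + c 1 + c 2 = b
    · have hm : natz c 0 + natz c 1 + natz c 2 = b := by
        have a0 := h 0
        have a1 := h 1
        have a2 := h 2
        simp only [natz, Finsupp.equivFunOnFinite_symm_apply_apply]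
        omega
      have := Ph_rep a b (fun m : Mon b => (⟨g (emb m.1), (hg _).1⟩ : ⋀[K]^a V))
        ⟨natz c, mon_mem _ hm⟩
      simp only [hc] at this
      exact this
    · rw [(hg c).2 hb, (Ph_Hom a b _ c).2 hb]
  · push Not at h
    obtain ⟨j, hj⟩ := h
    rw [hN j c hj, Ph_Nn a b _ j c hj]

lemma Ph_scast (a : ℕ) {b b' : ℕ} (h : b = b') (t : (⋀[K]^a V) ⊗[K] (S K 2 b)) :
    Ph V a b' (TensorProduct.congr (LinearEquiv.refl K (⋀[K]^a V)) (scast K h) t) = Ph V a b t := by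
  subst h
  induction t with
  | zero => simp
  | add x y hx hy => rw [map_add, map_add, map_add, hx, hy]
  | tmul x w => rfl

end

lemma skipAt_eq {a : ℕ} (j : Fin (a + 1)) (i : Fin a) : skipAt j i = j.succAbove i := by
  ext
  simp only [skipAt, Fin.succAbove, Fin.lt_def]
  simp only [Fin.val_castSucc]
  split_ifs <;> rfl

lemma intertwine (d a b : ℕ)
    (δ : ((⋀[K]^(a + 1) (S K 2 d)) ⊗[K] (S K 2 b)) →ₗ[K]
         ((⋀[K]^a (S K 2 d)) ⊗[K] (S K 2 (b + d))))
    (hδ : IsKoszulMap K 2 d (a + 1) b δ) (t : (⋀[K]^(a + 1) (S K 2 d)) ⊗[K] (S K 2 b)) :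
    DD cf (Ph (S K 2 d) (a + 1) b t) = Ph (S K 2 d) a (b + d) (δ t) := by
  have key : (DD cf) ∘ₗ (Ph (S K 2 d) (a + 1) b) = (Ph (S K 2 d) a (b + d)) ∘ₗ δ := by
    apply TensorProduct.ext
    apply exteriorPower.linearMap_ext
    apply AlternatingMap.ext
    intro s
    apply LinearMap.ext
    intro w
    change DD cf (Ph (S K 2 d) (a + 1) b (wedge K (a + 1) s ⊗ₜ w)) =
      Ph (S K 2 d) a (b + d) (δ (wedge K (a + 1) s ⊗ₜ w))
    rw [hδ s w]
    ext c
    rw [DD_apply]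
    simp only [Ph_tmul, map_smul]
    have hw : (wedge K (a + 1) s).1 = ExteriorAlgebra.ιMulti K (a + 1) s := rfl
    simp only [hw, ct_ιMulti]
    rw [map_sum, Finset.sum_apply]
    have hr : ∀ j : Fin (a + 1), Ph (S K 2 d) a (b + d) (((-1 : K) ^ (j : ℕ)) •
        ((wedge K (a + 1 - 1) fun i => s (skipAt j i)) ⊗ₜ[K] mulSW K (s j) w)) c =
        ((-1 : K) ^ (j : ℕ)) • (cZ c ((s j).1 * w.1) •
          ExteriorAlgebra.ιMulti K a (fun i => s (j.succAbove i))) := by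
      intro j
      rw [map_smul, Pi.smul_apply]
      congr 1
    refine Eq.trans ?_ (Finset.sum_congr rfl fun j _ => (hr j).symm)
    simp only [cZ_mul, Finset.smul_sum, Finset.sum_smul, smul_smul]
    rw [Finset.sum_comm]
    refine Finset.sum_congr rfl fun j _ => Finset.sum_congr rfl fun m _ => ?_
    congr 1
    ring
  exact LinearMap.congr_fun key t

end Bridge

end

/-- for `n = 2`, `d ≥ 3`, the Veronese–Koszul complex at `(i,q)` is exact for all
`1 ≤ i ≤ 3d−3` and all `q ≥ 2` (property `N_{3d−3}` for the `d`-uple Veronese surface). -/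
theorem stmt8 (K : Type*) [Field K] [CharZero K] (d : ℕ) (hd : 3 ≤ d) :
    ∀ i, 1 ≤ i → i ≤ 3 * d - 3 → ∀ q, 2 ≤ q → VKExact K 2 d i q := by
  intro i hi hi2 q hq h δ₁ δ₂ hδ₁ hδ₂
  obtain ⟨a, rfl⟩ : ∃ a, i = a + 1 := ⟨i - 1, by omega⟩
  have I1 := intertwine d a (q * d) δ₁ hδ₁
  have I2 := intertwine d (a + 1) ((q - 1) * d) δ₂ hδ₂
  apply le_antisymm
  · intro t ht
    have hz : DD cf (Ph (S K 2 d) (a + 1) (q * d) t) = 0 := by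
      rw [I1, LinearMap.mem_ker.1 ht, map_zero]
    obtain ⟨g, hgH, hgN, hg⟩ := cech xm cf cf_xm_self cf_xm_ne (a + 1) ((q * d : ℕ) : ℤ) _ hz
      (Ph_Nn _ _ t) (Ph_Hom _ _ t) (by
        intro y hy
        rcases Nat.eq_or_lt_of_le hq with rfl | hq3
        · have e1 : ((2 * d : ℕ) : ℤ) - d - d - d = -(d : ℤ) := by push_cast; ring
          rw [e1] at hy ⊢
          exact green hd xm cf cf_xm_self cf_xm_ne (xm_span d) (a + 1 + 3) (by omega) y hy
        · refine ⟨0, zero_mem _, fun c c0 c1 c2 => ?_⟩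
          rw [map_zero, (hy c).2]
          · rfl
          · have : 3 * d ≤ q * d := Nat.mul_le_mul_right d hq3
            omega)
    have e2 : ((q * d : ℕ) : ℤ) - d = (((q - 1) * d : ℕ) : ℤ) := by
      rw [← h]; push_cast; ring
    rw [e2] at hgH
    obtain ⟨s, hs⟩ := Ph_surj (a + 1 + 1) ((q - 1) * d) g hgH hgN
    refine ⟨s, ?_⟩
    apply Ph_injective
    rw [← hg, ← hs, I2]
    exact Ph_scast (a + 1) h (δ₂ s)
  · rintro _ ⟨s, rfl⟩
    rw [LinearMap.mem_ker]
    apply Ph_injective (V := S K 2 d) a (q * d + d)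
    rw [map_zero]
    have e3 : Ph (S K 2 d) (a + 1) (q * d) ((TensorProduct.congr
        (LinearEquiv.refl K (⋀[K]^(a + 1) (S K 2 d))) (scast K h)) (δ₂ s)) =
        Ph (S K 2 d) (a + 1) ((q - 1) * d + d) (δ₂ s) := Ph_scast (a + 1) h (δ₂ s)
    refine (I1 _).symm.trans ?_
    refine (congrArg (DD cf) e3).trans ?_
    rw [← I2, DD_DD]
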